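/- (Second contiguous relation for the Andrews/Li–Chu ₄φ₃ sums) Let n ≥ 1 be an integer, let p be a nonzero complex number and set q = p², and let b, d be complex numbers with b ≠ 0 such that (q;q)_n ≠ 0, (dq;q)_{n+1} ≠ 0, (dp;q)_{n+1} ≠ 0, (b²;q)_{n+2} ≠ 0, 1 + b ≠ 0, and 1 + bp ≠ 0. Define A_n(b,d;q) := ∑_{j=0}^{n} ((q^{-n};q)_j (b;q)_j (bp;q)_j (d²q^n;q)_j / ((q;q)_j (dq;q)_j (dp;q)_j (b²;q)_j)) q^j and B_n(b,d;q) := ∑_{j=0}^{n} ((q^{-n};q)_j (b;q)_j (bp;q)_j (d²q^{n+1};q)_j / ((q;q)_j (dq;q)_j (dp;q)_j (b²q;q)_j)) q^j. Then A_n(b,d;q) − B_{n−1}(b,d;q) = (q(1 − d²q^n)(b² − q^{-n}) / ((1+b)(1+bp)(1−dq)(1−dp))) · A_{n−1}(bq, dq; q), where A_{n−1}(bq,dq;q) is A with b replaced by bq, d replaced by dq, and n replaced by n−1. -/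

import Mathlib

/-- The $q$-shifted factorial $(a;q)_m = \prod_{k=0}^{m-1}(1 - a q^k)$. -/
noncomputable def qPoch (q a : ℂ) (m : ℕ) : ℂ := ∏ k ∈ Finset.range m, (1 - a * q ^ k)

/-- The first Andrews/Li–Chu ${}_4\phi_3$ sum $A_n(b,d;q)$ with $q = p^2$. -/
noncomputable def A4 (p b d : ℂ) (n : ℕ) : ℂ :=
  ∑ j ∈ Finset.range (n + 1),
    qPoch (p ^ 2) ((p ^ 2) ^ (-(n : ℤ))) j * qPoch (p ^ 2) b j * qPoch (p ^ 2) (b * p) j *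
      qPoch (p ^ 2) (d ^ 2 * (p ^ 2) ^ n) j /
      (qPoch (p ^ 2) (p ^ 2) j * qPoch (p ^ 2) (d * p ^ 2) j * qPoch (p ^ 2) (d * p) j *
        qPoch (p ^ 2) (b ^ 2) j) * (p ^ 2) ^ j

/-- The second Andrews/Li–Chu ${}_4\phi_3$ sum $B_n(b,d;q)$ with $q = p^2$. -/
noncomputable def B4 (p b d : ℂ) (n : ℕ) : ℂ :=
  ∑ j ∈ Finset.range (n + 1),
    qPoch (p ^ 2) ((p ^ 2) ^ (-(n : ℤ))) j * qPoch (p ^ 2) b j * qPoch (p ^ 2) (b * p) j *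
      qPoch (p ^ 2) (d ^ 2 * (p ^ 2) ^ (n + 1)) j /
      (qPoch (p ^ 2) (p ^ 2) j * qPoch (p ^ 2) (d * p ^ 2) j * qPoch (p ^ 2) (d * p) j *
        qPoch (p ^ 2) (b ^ 2 * p ^ 2) j) * (p ^ 2) ^ j

theorem qPoch_zero (q a : ℂ) : qPoch q a 0 = 1 := by
  simp [qPoch]

theorem qPoch_succ (q a : ℂ) (m : ℕ) :
    qPoch q a (m + 1) = qPoch q a m * (1 - a * q ^ m) := by
  simp [qPoch, Finset.prod_range_succ]

theorem qPoch_succ_left (q a : ℂ) (m : ℕ) :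
    qPoch q a (m + 1) = (1 - a) * qPoch q (a * q) m := by
  simp only [qPoch, Finset.prod_range_succ', pow_zero, mul_one]
  rw [mul_comm]
  congr 1
  refine Finset.prod_congr rfl fun k _ => ?_
  ring

theorem qPoch_ne_zero_of_le {q a : ℂ} {k m : ℕ} (hkm : k ≤ m) (h : qPoch q a m ≠ 0) :
    qPoch q a k ≠ 0 := by
  simp only [qPoch, Finset.prod_ne_zero_iff, Finset.mem_range] at h ⊢
  exact fun i hi => h i (by omega)

theorem qPoch_zpow_neg_eq_zero {q : ℂ} (hq : q ≠ 0) (m : ℕ) :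
    qPoch q (q ^ (-(m : ℤ))) (m + 1) = 0 := by
  rw [qPoch_succ, zpow_neg, zpow_natCast, inv_mul_cancel₀ (pow_ne_zero m hq), sub_self, mul_zero]

/-- Second contiguous relation for the Andrews/Li–Chu ${}_4\phi_3$ sums. -/
theorem second_contiguous (n : ℕ) (hn : 1 ≤ n) (p b d : ℂ) (hp : p ≠ 0) (hb : b ≠ 0)
    (h1 : qPoch (p ^ 2) (p ^ 2) n ≠ 0) (h2 : qPoch (p ^ 2) (d * p ^ 2) (n + 1) ≠ 0)
    (h3 : qPoch (p ^ 2) (d * p) (n + 1) ≠ 0) (h4 : qPoch (p ^ 2) (b ^ 2) (n + 2) ≠ 0)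
    (h5 : 1 + b ≠ 0) (h6 : 1 + b * p ≠ 0) :
    A4 p b d n - B4 p b d (n - 1)
      = p ^ 2 * (1 - d ^ 2 * (p ^ 2) ^ n) * (b ^ 2 - (p ^ 2) ^ (-(n : ℤ))) /
          ((1 + b) * (1 + b * p) * (1 - d * p ^ 2) * (1 - d * p))
          * A4 p (b * p ^ 2) (d * p ^ 2) (n - 1) := by
  obtain ⟨m, rfl⟩ : ∃ m, n = m + 1 := ⟨n - 1, by omega⟩
  have hq : p ^ 2 ≠ 0 := pow_ne_zero 2 hp
  have hx : (p ^ 2) ^ (-(m : ℤ)) = (p ^ 2) ^ (-((m + 1 : ℕ) : ℤ)) * p ^ 2 := by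
    rw [← zpow_add_one₀ hq]
    congr 1
    push_cast
    ring
  have hB : B4 p b d m = ∑ j ∈ Finset.range (m + 1 + 1),
      qPoch (p ^ 2) ((p ^ 2) ^ (-(m : ℤ))) j * qPoch (p ^ 2) b j * qPoch (p ^ 2) (b * p) j *
        qPoch (p ^ 2) (d ^ 2 * (p ^ 2) ^ (m + 1)) j /
        (qPoch (p ^ 2) (p ^ 2) j * qPoch (p ^ 2) (d * p ^ 2) j * qPoch (p ^ 2) (d * p) j *
          qPoch (p ^ 2) (b ^ 2 * p ^ 2) j) * (p ^ 2) ^ j := by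
    rw [Finset.sum_range_succ, qPoch_zpow_neg_eq_zero hq]
    simp [B4]
  rw [Nat.add_sub_cancel, hB, A4, A4, ← Finset.sum_sub_distrib, Finset.sum_range_succ',
    Finset.mul_sum]
  simp only [qPoch_zero, sub_self, add_zero]
  refine Finset.sum_congr rfl fun k hk => ?_
  have hk : k ≤ m := by simpa [Nat.lt_succ_iff] using hk
  have h1 := qPoch_ne_zero_of_le (show k + 1 ≤ m + 1 by omega) h1
  have h2 := qPoch_ne_zero_of_le (show k + 1 ≤ m + 1 + 1 by omega) h2
  have h3 := qPoch_ne_zero_of_le (show k + 1 ≤ m + 1 + 1 by omega) h3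
  have h4 := qPoch_ne_zero_of_le (show k + 1 + 1 ≤ m + 1 + 2 by omega) h4
  have hd : (d * p ^ 2) ^ 2 * (p ^ 2) ^ m = d ^ 2 * (p ^ 2) ^ (m + 1) * p ^ 2 := by ring
  have hbp : b * p ^ 2 * p = b * p * p ^ 2 := by ring
  have hdp : d * p ^ 2 * p = d * p * p ^ 2 := by ring
  have hbb : (b * p ^ 2) ^ 2 = b ^ 2 * p ^ 2 * p ^ 2 := by ring
  have hU := (qPoch_succ_left (p ^ 2) (b ^ 2 * p ^ 2) k).symm.trans (qPoch_succ _ _ k)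
  rw [hd, hbp, hdp, hbb, hx, qPoch_succ_left _ ((p ^ 2) ^ (-((m + 1 : ℕ) : ℤ))),
    qPoch_succ _ ((p ^ 2) ^ (-((m + 1 : ℕ) : ℤ)) * p ^ 2),
    qPoch_succ_left _ b, qPoch_succ_left _ (b * p), qPoch_succ_left _ (d ^ 2 * _),
    qPoch_succ _ (p ^ 2), qPoch_succ_left _ (d * p ^ 2), qPoch_succ_left _ (d * p),
    qPoch_succ_left _ (b ^ 2), qPoch_succ _ (b ^ 2 * p ^ 2)]
  rw [qPoch_succ] at h1
  rw [qPoch_succ_left] at h2 h3 h4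
  have h4U := right_ne_zero_of_mul h4
  rw [qPoch_succ] at h4U
  have h4V := right_ne_zero_of_mul h4
  rw [qPoch_succ_left] at h4V
  generalize (p ^ 2) ^ (-((m + 1 : ℕ) : ℤ)) = x at *
  generalize qPoch (p ^ 2) (x * p ^ 2) k = X at *
  generalize qPoch (p ^ 2) (b * p ^ 2) k = Y at *
  generalize qPoch (p ^ 2) (b * p * p ^ 2) k = Z at *
  generalize qPoch (p ^ 2) (d ^ 2 * (p ^ 2) ^ (m + 1) * p ^ 2) k = W at *
  generalize (p ^ 2) ^ (m + 1) = t at *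
  generalize qPoch (p ^ 2) (p ^ 2) k = Q at *
  generalize qPoch (p ^ 2) (d * p ^ 2 * p ^ 2) k = D at *
  generalize qPoch (p ^ 2) (d * p * p ^ 2) k = E at *
  generalize qPoch (p ^ 2) (b ^ 2 * p ^ 2 * p ^ 2) k = V at *
  generalize qPoch (p ^ 2) (b ^ 2 * p ^ 2) k = U at *
  rw [pow_succ (p ^ 2) k]
  generalize (p ^ 2) ^ k = r at *
  simp only [mul_ne_zero_iff] at h1 h2 h3 h4 h4U h4V
  obtain ⟨hQ, hr⟩ := h1
  obtain ⟨hd2, hD⟩ := h2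
  obtain ⟨hd1, hE⟩ := h3
  obtain ⟨hb1, -⟩ := h4
  obtain ⟨hU0, hUr⟩ := h4U
  obtain ⟨hbq, hV0⟩ := h4V
  obtain rfl : V = U * (1 - b ^ 2 * p ^ 2 * r) / (1 - b ^ 2 * p ^ 2) := by
    rw [eq_div_iff hbq, mul_comm, hU]
  have e1 : 1 - b ^ 2 = (1 - b) * (1 + b) := by ring
  have e2 : 1 - b ^ 2 * p ^ 2 = (1 - b * p) * (1 + b * p) := by ring
  have hb1' : 1 - b ≠ 0 := left_ne_zero_of_mul (e1 ▸ hb1)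
  have hbq' : 1 - b * p ≠ 0 := left_ne_zero_of_mul (e2 ▸ hbq)
  rw [e1, e2]
  clear hU hV0
  field_simp
  ring
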